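/- arXiv:2602.23030 — 2 statements merged into one kernel-verified Lean document; each statement's English description precedes it below -/
import Mathlib

section
/- Let Σ be a finite alphabet of size k ≥ 2. There exist infinite words x, y ∈ Σ^∞ such that (i) x and y are both normal, and (ii) for every shuffler S over Σ, the shuffled output S(x,y) is normal. -/
open MeasureTheory Filter Finset
open scoped ENNReal ProbabilityTheory

/-- A deterministic shuffler over the alphabet `Fin k`, with state set `Fin S.n`.
`τ q = true` means: read from tape 1 (the `x` tape); `τ q = false` means tape 2. -/
structure Shuffler (k : ℕ) where
  n : ℕ
  q0 : Fin n
  δ : Fin n → Fin k → Fin n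
  τ : Fin n → Bool

namespace Shuffler

variable {k : ℕ}

/-- Configuration after `t` output steps: current state, and the numbers of symbols
consumed from tape 1 and from tape 2. -/
def conf (S : Shuffler k) (x y : ℕ → Fin k) : ℕ → Fin S.n × ℕ × ℕ
  | 0 => (S.q0, 0, 0)
  | t + 1 =>
    match S.conf x y t with
    | (q, a, b) =>
      if S.τ q then (S.δ q (x a), a + 1, b) else (S.δ q (y b), a, b + 1)

/-- The shuffled output word `S(x,y) : ℕ → Fin k`. -/
def out (S : Shuffler k) (x y : ℕ → Fin k) (t : ℕ) : Fin k :=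
  match S.conf x y t with
  | (q, a, b) => if S.τ q then x a else y b

end Shuffler

/-- The length-`n` prefix of an infinite word. -/
def wpre {k : ℕ} (x : ℕ → Fin k) (n : ℕ) : List (Fin k) :=
  List.ofFn (fun i : Fin n => x i)

/-- Overlapping occurrence count of the block `w` inside the finite word `u`. -/
def occ {k : ℕ} (u w : List (Fin k)) : ℕ :=
  ((Finset.range (u.length + 1 - w.length)).filter
    (fun t => (u.drop t).take w.length = w)).card

/-- Aligned (non-overlapping) occurrence count of `w` among the consecutive
`|w|`-blocks of `u`. -/
def alocc {k : ℕ} (u w : List (Fin k)) : ℕ :=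
  ((Finset.range (u.length / w.length)).filter
    (fun j => (u.drop (j * w.length)).take w.length = w)).card

/-- Borel normality of an infinite word over `Fin k`. -/
def IsNormal {k : ℕ} (z : ℕ → Fin k) : Prop :=
  ∀ w : List (Fin k), w ≠ [] →
    Tendsto (fun n => (occ (wpre z n) w : ℝ) / (n : ℝ)) atTop
      (nhds ((1 : ℝ) / (k : ℝ) ^ w.length))

/-- The cylinder determined by a finite word. -/
def cyl {k : ℕ} (u : List (Fin k)) : Set (ℕ → Fin k) :=
  {x | wpre x u.length = u}

/-- `ν` is the i.i.d. uniform product measure on `ℕ → Fin k`: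
it gives every cylinder of a length-`n` word measure `k⁻ⁿ`. -/
def IsUniformProductMeasure {k : ℕ} (ν : Measure (ℕ → Fin k)) : Prop :=
  IsProbabilityMeasure ν ∧ ∀ u : List (Fin k), ν (cyl u) = ((k : ℝ≥0∞))⁻¹ ^ u.length

noncomputable def elln (k n : ℕ) : ℕ := ⌊Real.logb k n / 3⌋₊

noncomputable def epsn (k n : ℕ) : ℝ :=
  2 * Real.sqrt (Real.log n * Real.logb k n / n)

def mnr (n r : ℕ) : ℕ := n / r

/-- The good event `E_S(n, r, w)` (with `r = w.length`). -/
def ESet {k : ℕ} (S : Shuffler k) (n : ℕ) (w : List (Fin k)) :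
    Set ((ℕ → Fin k) × (ℕ → Fin k)) :=
  {p | |(alocc (wpre (S.out p.1 p.2) n) w : ℝ) - (mnr n w.length : ℝ) / (k : ℝ) ^ w.length|
        < epsn k n * (mnr n w.length : ℝ)}

/-- Total conditional bad mass `B_n(u,v)` for the first `n` shufflers of the sequence `S`. -/
noncomputable def Bn {k : ℕ} (μ : Measure ((ℕ → Fin k) × (ℕ → Fin k)))
    (S : ℕ → Shuffler k) (n : ℕ) (u v : List (Fin k)) : ℝ≥0∞ :=
  ∑ i ∈ Finset.Icc 1 n, ∑ r ∈ Finset.Icc 1 (elln k n), ∑ w : Fin r → Fin k,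
    ProbabilityTheory.cond μ (cyl u ×ˢ cyl v) (ESet (S i) n (List.ofFn w))ᶜ

/-- The rolling potential `Φ_L(u,v)` with checkpoints `N_j = (j+m₀)^4`
and activation lengths `A_j = (j+m₀)^2`. -/
noncomputable def Phi {k : ℕ} (μ : Measure ((ℕ → Fin k) × (ℕ → Fin k)))
    (S : ℕ → Shuffler k) (m₀ : ℕ) (L : ℕ) (u v : List (Fin k)) : ℝ≥0∞ :=
  ∑ j ∈ (Finset.Icc 1 L).filter (fun j => (j + m₀) ^ 2 ≤ L ∧ L ≤ (j + m₀) ^ 4),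
    Bn μ S ((j + m₀) ^ 4) u v

/-- `Test(u; m, ε)`: all `m`-blocks of `u` have frequency within `ε` of `k^{-m}`. -/
def TestP {k : ℕ} (u : List (Fin k)) (m : ℕ) (ε : ℝ) : Prop :=
  ∀ w : List (Fin k), w.length = m →
    |(occ u w : ℝ) / (u.length : ℝ) - (1 : ℝ) / (k : ℝ) ^ m| ≤ ε

/-- The test event `E_S(n; m, ε)`. -/
def ETest {k : ℕ} (S : Shuffler k) (n m : ℕ) (ε : ℝ) :
    Set ((ℕ → Fin k) × (ℕ → Fin k)) :=
  {p | TestP (wpre (S.out p.1 p.2) n) m ε}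

/-- The quadratic window slice `H_t(N)(x)`. -/
def Hslice {k : ℕ} (S : ℕ → Shuffler k) (t N : ℕ) (x : ℕ → Fin k) :
    Set (ℕ → Fin k) :=
  ⋂ i ∈ Finset.Icc 1 t, ⋂ ℓ ∈ Finset.Icc 1 t, ⋂ n ∈ Finset.Icc N (N ^ 2),
    {y | (x, y) ∈ ETest (S i) n ℓ ((1 : ℝ) / 2 ^ t)}

/-- A finite encoding of a shuffler, suitable for computability statements. -/
def Shuffler.encode {k : ℕ} (S : Shuffler k) : ℕ × ℕ × List ℕ × List Bool :=
  (S.n, (S.q0 : ℕ),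
    (List.finRange S.n).flatMap (fun q => (List.finRange k).map (fun a => ((S.δ q a : ℕ)))),
    (List.finRange S.n).map S.τ)

/-! ### The uniform Bernoulli measure -/

/-- The i.i.d. uniform measure on infinite words over `Fin k`. -/
noncomputable def unifMeasure (k : ℕ) : Measure (ℕ → Fin k) :=
  Measure.infinitePi fun _ => ProbabilityTheory.uniformOn Set.univ

instance (k : ℕ) [NeZero k] : IsProbabilityMeasure (unifMeasure k) := by
  unfold unifMeasure; infer_instance

lemma uniformOn_univ_fin_singleton (k : ℕ) (c : Fin k) :
    ProbabilityTheory.uniformOn (Set.univ : Set (Fin k)) {c} = (k : ℝ≥0∞)⁻¹ := by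
  rw [ProbabilityTheory.uniformOn_univ]
  simp

lemma unifMeasure_prefix (k : ℕ) [NeZero k] (f : ℕ → Fin k) (a : ℕ) :
    unifMeasure k {x | ∀ i < a, x i = f i} = (k : ℝ≥0∞)⁻¹ ^ a := by
  have h : {x : ℕ → Fin k | ∀ i < a, x i = f i} = Set.pi (Finset.range a) fun i => {f i} := by
    ext x; simp [Set.mem_pi]
  rw [h, unifMeasure, Measure.infinitePi_pi _ (fun _ _ => MeasurableSet.of_discrete)]
  simp [uniformOn_univ_fin_singleton]

/-- The i.i.d. uniform measure is the only finite measure giving prefix cylinders the right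
mass. -/
lemma eq_unifMeasure {k : ℕ} [NeZero k] {ν : Measure (ℕ → Fin k)}
    (h : ∀ (f : ℕ → Fin k) (n : ℕ), ν {z | ∀ i < n, z i = f i} = (k : ℝ≥0∞)⁻¹ ^ n) :
    ν = unifMeasure k := by
  refine (Measure.isProjectiveLimit_infinitePi _).unique ?_ |>.symm
  refine (isProjectiveLimit_nat_iff (isProjectiveMeasureFamily_pi fun _ : ℕ =>
    ProbabilityTheory.uniformOn (Set.univ : Set (Fin k))) ν).2 ?_
  intro n
  refine Measure.ext_of_singleton fun g => ?_
  let f : ℕ → Fin k := fun i => if hi : i ∈ Finset.Iic n then g ⟨i, hi⟩ else 0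
  have hpre : Preorder.frestrictLe (π := fun _ => Fin k) n ⁻¹' {g} =
      {z | ∀ i < n + 1, z i = f i} := by
    ext z
    simp only [Set.mem_preimage, Set.mem_singleton_iff, funext_iff, Subtype.forall,
      Set.mem_ofPred_eq, Preorder.frestrictLe_apply]
    refine forall_congr' fun i => ?_
    by_cases hi : i ∈ Finset.Iic n
    · have : i < n + 1 := Nat.lt_succ_of_le (Finset.mem_Iic.1 hi)
      simp only [hi, this, forall_true_left, f, dif_pos]
    · have : ¬ i < n + 1 := fun h' => hi (Finset.mem_Iic.2 (Nat.le_of_lt_succ h'))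
      simp only [hi, this, IsEmpty.forall_iff]
  rw [Measure.map_apply (Preorder.measurable_frestrictLe n) (measurableSet_singleton g), hpre, h]
  rw [← Set.univ_pi_singleton, Measure.pi_pi]
  simp [uniformOn_univ_fin_singleton]

/-! ### Shuffles of random words -/

namespace Shuffler

/-- The pairs of words whose shuffle has a given prefix form a product of two prefix
cylinders, and the configuration reached is constant on them. -/
lemma prefix_out_iff {k : ℕ} (S : Shuffler k) (z : ℕ → Fin k) (n : ℕ) :
    ∃ (q : Fin S.n) (a b : ℕ) (f g : ℕ → Fin k), a + b = n ∧ ∀ x y,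
      ((∀ i < n, S.out x y i = z i) ↔ (∀ i < a, x i = f i) ∧ (∀ i < b, y i = g i)) ∧
      ((∀ i < n, S.out x y i = z i) → S.conf x y n = (q, a, b)) := by
  have extend : ∀ (f x : ℕ → Fin k) (a : ℕ) (c : Fin k),
      (∀ i < a + 1, x i = Function.update f a c i) ↔ (∀ i < a, x i = f i) ∧ x a = c := by
    intro f x a c
    rw [Nat.forall_lt_succ_right, Function.update_self]
    refine and_congr_left fun _ => forall₂_congr fun i hi => ?_
    rw [Function.update_of_ne hi.ne]
  induction n with
  | zero => exact ⟨S.q0, 0, 0, z, z, rfl, fun x y => by simp [conf]⟩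
  | succ n ih =>
    obtain ⟨q, a, b, f, g, hab, H⟩ := ih
    by_cases hq : S.τ q
    · refine ⟨S.δ q (z n), a + 1, b, Function.update f a (z n), g, by omega, fun x y => ?_⟩
      have hout : (∀ i < n, S.out x y i = z i) → S.out x y n = x a := fun h => by
        simp [out, (H x y).2 h, hq]
      rw [extend, Nat.forall_lt_succ_right]
      refine ⟨⟨fun h => ?_, fun h => ?_⟩, fun h => ?_⟩
      · have := (H x y).1.1 h.1
        exact ⟨⟨this.1, (hout h.1).symm.trans h.2⟩, this.2⟩
      · have := (H x y).1.2 ⟨h.1.1, h.2⟩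
        exact ⟨this, (hout this).trans h.1.2⟩
      · have := (hout h.1).symm.trans h.2
        simp [conf, (H x y).2 h.1, hq, this]
    · refine ⟨S.δ q (z n), a, b + 1, f, Function.update g b (z n), by omega, fun x y => ?_⟩
      have hout : (∀ i < n, S.out x y i = z i) → S.out x y n = y b := fun h => by
        simp [out, (H x y).2 h, hq]
      rw [extend, Nat.forall_lt_succ_right]
      refine ⟨⟨fun h => ?_, fun h => ?_⟩, fun h => ?_⟩
      · have := (H x y).1.1 h.1
        exact ⟨this.1, this.2, (hout h.1).symm.trans h.2⟩
      · have := (H x y).1.2 ⟨h.1, h.2.1⟩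
        exact ⟨this, (hout this).trans h.2.2⟩
      · have := (hout h.1).symm.trans h.2
        simp [conf, (H x y).2 h.1, hq, this]

lemma measurable_conf {k : ℕ} (S : Shuffler k) (t : ℕ) :
    Measurable fun p : (ℕ → Fin k) × (ℕ → Fin k) => S.conf p.1 p.2 t := by
  induction t with
  | zero => exact measurable_const
  | succ t ih =>
    have hstep : Measurable fun r : (Fin S.n × ℕ × ℕ) × ((ℕ → Fin k) × (ℕ → Fin k)) =>
        if S.τ r.1.1 then (S.δ r.1.1 (r.2.1 r.1.2.1), r.1.2.1 + 1, r.1.2.2)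
        else (S.δ r.1.1 (r.2.2 r.1.2.2), r.1.2.1, r.1.2.2 + 1) := by
      refine measurable_from_prod_countable_right fun c => ?_
      by_cases hq : S.τ c.1
      · simp only [hq, if_true]
        exact (measurable_from_top (f := fun α => (S.δ c.1 α, c.2.1 + 1, c.2.2))).comp
          ((measurable_pi_apply c.2.1).comp measurable_fst)
      · simp only [hq]
        exact (measurable_from_top (f := fun α => (S.δ c.1 α, c.2.1, c.2.2 + 1))).comp
          ((measurable_pi_apply c.2.2).comp measurable_snd)
    exact hstep.comp (ih.prodMk measurable_id)

lemma measurable_out {k : ℕ} (S : Shuffler k) :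
    Measurable fun p : (ℕ → Fin k) × (ℕ → Fin k) => S.out p.1 p.2 := by
  refine measurable_pi_lambda _ fun t => ?_
  have hread : Measurable fun r : (Fin S.n × ℕ × ℕ) × ((ℕ → Fin k) × (ℕ → Fin k)) =>
      if S.τ r.1.1 then r.2.1 r.1.2.1 else r.2.2 r.1.2.2 := by
    refine measurable_from_prod_countable_right fun c => ?_
    by_cases hq : S.τ c.1
    · simp only [hq, if_true]
      exact (measurable_pi_apply c.2.1).comp measurable_fst
    · simp only [hq]
      exact (measurable_pi_apply c.2.2).comp measurable_snd
  exact hread.comp ((S.measurable_conf t).prodMk measurable_id)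

/-- Any shuffle of two independent uniform random words is a uniform random word. -/
lemma measurePreserving_out {k : ℕ} [NeZero k] (S : Shuffler k) :
    MeasurePreserving (fun p : (ℕ → Fin k) × (ℕ → Fin k) => S.out p.1 p.2)
      ((unifMeasure k).prod (unifMeasure k)) (unifMeasure k) := by
  refine ⟨S.measurable_out, eq_unifMeasure fun z n => ?_⟩
  obtain ⟨q, a, b, f, g, hab, H⟩ := S.prefix_out_iff z n
  have hpre : (fun p : (ℕ → Fin k) × (ℕ → Fin k) => S.out p.1 p.2) ⁻¹'
      {w | ∀ i < n, w i = z i} = {x | ∀ i < a, x i = f i} ×ˢ {y | ∀ i < b, y i = g i} := by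
    ext p
    exact (H p.1 p.2).1
  have hmeas : MeasurableSet {w : ℕ → Fin k | ∀ i < n, w i = z i} := by
    simp only [Set.ofPred_forall]
    exact .iInter fun i => .iInter fun _ => measurableSet_eq_fun (measurable_pi_apply i)
      measurable_const
  rw [Measure.map_apply S.measurable_out hmeas, hpre, Measure.prod_prod, unifMeasure_prefix,
    unifMeasure_prefix, ← pow_add, hab]

instance (k : ℕ) : Countable (Shuffler k) := by
  let F : Shuffler k → Σ n : ℕ, Fin n × (Fin n → Fin k → Fin n) × (Fin n → Bool) :=
    fun S => ⟨S.n, S.q0, S.δ, S.τ⟩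
  refine Function.Injective.countable (f := F) ?_
  rintro ⟨n, q, d, t⟩ ⟨n', q', d', t'⟩ h
  simp only [F, Sigma.mk.injEq] at h
  obtain ⟨rfl, h⟩ := h
  simp_all

end Shuffler

/-! ### The normal number theorem of Borel -/

/-- If the averages of a bounded sequence along every residue class mod `m` converge to `p`,
then so do its averages. -/
lemma tendsto_average_of_residues {X : ℕ → ℝ} {m : ℕ} (hm : 0 < m) {p : ℝ}
    (h0 : ∀ t, 0 ≤ X t) (h1 : ∀ t, X t ≤ 1)
    (h : ∀ r < m, Tendsto (fun N : ℕ => (∑ j ∈ range N, X (j * m + r)) / N) atTop (nhds p)) :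
    Tendsto (fun n : ℕ => (∑ t ∈ range n, X t) / n) atTop (nhds p) := by
  have hblock : ∀ N : ℕ, ∑ t ∈ range (N * m), X t =
      ∑ r ∈ range m, ∑ j ∈ range N, X (j * m + r) := by
    intro N
    induction N with
    | zero => simp
    | succ N ih =>
      rw [Nat.succ_mul, Finset.sum_range_add, ih]
      simp only [Finset.sum_range_succ _ N, Finset.sum_add_distrib]
  have hm' : (m : ℝ) ≠ 0 := by positivity
  have hA : Tendsto (fun N : ℕ => (∑ t ∈ range (N * m), X t) / N) atTop (nhds (m * p)) := by
    have := tendsto_finsetSum (range m) fun r hr => h r (Finset.mem_range.1 hr)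
    simp only [Finset.sum_const, card_range, nsmul_eq_mul] at this
    refine this.congr fun N => ?_
    rw [hblock, Finset.sum_div]
  have hdiv : Tendsto (fun n : ℕ => n / m) atTop atTop := Nat.tendsto_div_const_atTop hm.ne'
  have hratio : Tendsto (fun n : ℕ => ((n / m : ℕ) : ℝ) / n) atTop (nhds (m : ℝ)⁻¹) := by
    have := (tendsto_nat_floor_mul_div_atTop (R := ℝ) (a := (m : ℝ)⁻¹) (by positivity)).comp
      (tendsto_natCast_atTop_atTop (R := ℝ))
    refine this.congr fun n => ?_
    simp only [Function.comp]
    rw [inv_mul_eq_div, Nat.floor_div_natCast, Nat.floor_natCast]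
  have hmain : Tendsto (fun n : ℕ => (∑ t ∈ range (n / m * m), X t) / n) atTop (nhds p) := by
    have := (hA.comp hdiv).mul hratio
    rw [show m * p * (m : ℝ)⁻¹ = p by field_simp] at this
    refine this.congr' ?_
    filter_upwards [hdiv.eventually_gt_atTop 0] with n hn
    have : ((n / m : ℕ) : ℝ) ≠ 0 := by positivity
    simp only [Function.comp]
    field_simp
  have hupper : Tendsto (fun n : ℕ => (∑ t ∈ range (n / m * m), X t) / n + (m : ℝ) / n)
      atTop (nhds p) := by
    simpa using hmain.add (tendsto_const_div_atTop_nhds_zero_nat (m : ℝ))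
  refine tendsto_of_tendsto_of_tendsto_of_le_of_le hmain hupper (fun n => ?_) fun n => ?_
  · refine div_le_div_of_nonneg_right ?_ n.cast_nonneg
    exact Finset.sum_le_sum_of_subset_of_nonneg
      (Finset.range_subset_range.2 (Nat.div_mul_le_self n m)) fun t _ _ => h0 t
  · simp only
    rw [← add_div]
    refine div_le_div_of_nonneg_right ?_ n.cast_nonneg
    conv_lhs => rw [← Nat.div_add_mod' n m]
    rw [Finset.sum_range_add]
    gcongr
    calc _ ≤ ∑ _t ∈ range (n % m), (1 : ℝ) := Finset.sum_le_sum fun t _ => h1 _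
      _ = ((n % m : ℕ) : ℝ) := by simp
      _ ≤ m := by exact_mod_cast (Nat.mod_lt n hm).le

/-- The indicator of the block `w` occurring at position `t`. -/
noncomputable def blockInd {k m : ℕ} (w : Fin m → Fin k) (z : ℕ → Fin k) (t : ℕ) : ℝ :=
  Set.indicator {w} 1 fun i : Fin m => z (t + i)

lemma ae_tendsto_blockInd_residue {k : ℕ} [NeZero k] {m : ℕ} (w : Fin m → Fin k) (r : ℕ) :
    ∀ᵐ z ∂unifMeasure k, Tendsto
      (fun N : ℕ => (∑ j ∈ range N, blockInd w z (j * m + r)) / N) atTop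
      (nhds (1 / (k : ℝ) ^ m)) := by
  have hblock : ∀ t : ℕ, Measurable fun (z : ℕ → Fin k) (i : Fin m) => z (t + i) :=
    fun t => measurable_pi_lambda _ fun i => measurable_pi_apply _
  have hg : Measurable (Set.indicator {w} (1 : (Fin m → Fin k) → ℝ)) := .of_discrete
  have hmap : ∀ t : ℕ, (unifMeasure k).map (fun z (i : Fin m) => z (t + i)) =
      Measure.pi fun _ => ProbabilityTheory.uniformOn Set.univ := by
    intro t
    rw [← Measure.infinitePi_eq_pi]
    exact Measure.map_infinitePi_infinitePi_of_inj (f := fun i : Fin m => t + i)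
      fun i j hij => by simpa [Fin.ext_iff] using hij
  have hindep : ProbabilityTheory.iIndepFun (fun (i : ℕ) (z : ℕ → Fin k) => z i)
      (unifMeasure k) :=
    ProbabilityTheory.iIndepFun_infinitePi (X := fun _ c => c) fun _ => measurable_id
  have hint : ∫ z, blockInd w z (0 * m + r) ∂unifMeasure k = 1 / (k : ℝ) ^ m := by
    simp only [blockInd]
    rw [← integral_map (φ := fun (z : ℕ → Fin k) (i : Fin m) => z (0 * m + r + i))
      (f := Set.indicator {w} (1 : (Fin m → Fin k) → ℝ)) (hblock _).aemeasurable hg.aestronglyMeasurable, hmap,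
      integral_indicator_one .of_discrete, Measure.real, ← Set.univ_pi_singleton,
      Measure.pi_pi]
    simp [uniformOn_univ_fin_singleton]
  rw [← hint]
  refine ProbabilityTheory.strong_law_ae_real (fun j z => blockInd w z (j * m + r)) ?_ ?_ ?_
  · refine Integrable.of_bound (hg.comp (hblock _)).aestronglyMeasurable 1 (ae_of_all _ ?_)
    intro z
    simp only [blockInd, Set.indicator_apply]
    split_ifs <;> simp
  · intro j j' hne
    have hdisj : Disjoint (Finset.Ico (j * m + r) (j * m + r + m))
        (Finset.Ico (j' * m + r) (j' * m + r + m)) := by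
      rw [Finset.disjoint_left]
      intro t ht ht'
      rw [Finset.mem_Ico] at ht ht'
      rcases lt_or_gt_of_ne hne with h | h
      · have := Nat.mul_le_mul_right m (Nat.succ_le_of_lt h)
        rw [Nat.succ_mul] at this
        omega
      · have := Nat.mul_le_mul_right m (Nat.succ_le_of_lt h)
        rw [Nat.succ_mul] at this
        omega
    have hcomp : ∀ t : ℕ, Measurable fun v : Finset.Ico t (t + m) → Fin k =>
        Set.indicator {w} (1 : (Fin m → Fin k) → ℝ) fun i : Fin m =>
          v ⟨t + i, by simp⟩ := fun t => .of_discrete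
    exact (hindep.indepFun_finset _ _ hdisj fun i => measurable_pi_apply i).comp
      (hcomp (j * m + r)) (hcomp (j' * m + r))
  · intro j
    exact ProbabilityTheory.IdentDistrib.comp
      ⟨(hblock _).aemeasurable, (hblock _).aemeasurable, (hmap _).trans (hmap _).symm⟩ hg

lemma occ_wpre {k : ℕ} (z : ℕ → Fin k) (n : ℕ) (w : List (Fin k)) :
    (occ (wpre z n) w : ℝ) = ∑ t ∈ range (n + 1 - w.length), blockInd w.get z t := by
  have hlen : (wpre z n).length = n := by simp [wpre]
  rw [occ, Finset.card_filter, hlen, Nat.cast_sum]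
  refine Finset.sum_congr rfl fun t ht => ?_
  have ht' : t + w.length ≤ n := by
    have := Finset.mem_range.1 ht
    omega
  have hiff : ((wpre z n).drop t).take w.length = w ↔
      (fun i : Fin w.length => z (t + i)) = w.get := by
    constructor
    · intro h
      ext1 i
      have := List.getElem_of_eq h.symm i.2
      simp [wpre] at this
      simp [this]
    · intro h
      refine List.ext_getElem (by simp [wpre]; omega) fun i h1 h2 => ?_
      have := congrFun h ⟨i, h2⟩
      simpa [wpre] using this
  simp only [blockInd, Set.indicator_apply, Set.mem_singleton_iff, hiff]
  split_ifs <;> simp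

/-- Theorem of Borel: almost every word is normal. -/
lemma ae_isNormal (k : ℕ) [NeZero k] : ∀ᵐ z ∂unifMeasure k, IsNormal z := by
  have hall : ∀ᵐ z ∂unifMeasure k, ∀ (w : List (Fin k)) (r : ℕ), Tendsto
      (fun N : ℕ => (∑ j ∈ range N, blockInd w.get z (j * w.length + r)) / N) atTop
      (nhds (1 / (k : ℝ) ^ w.length)) :=
    ae_all_iff.2 fun w => ae_all_iff.2 fun r => ae_tendsto_blockInd_residue w.get r
  filter_upwards [hall] with z hz w hw
  have hm : 0 < w.length := List.length_pos_iff.2 hw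
  have h0 : ∀ t, 0 ≤ blockInd w.get z t := fun t =>
    Set.indicator_nonneg (fun _ _ => zero_le_one) _
  have h1 : ∀ t, blockInd w.get z t ≤ 1 := fun t => by
    simp only [blockInd, Set.indicator_apply]
    split_ifs <;> simp
  have hc := tendsto_average_of_residues hm h0 h1 fun r _ => hz w r
  have hlower : Tendsto (fun n : ℕ => (∑ t ∈ range n, blockInd w.get z t) / n -
      (w.length : ℝ) / n) atTop (nhds (1 / (k : ℝ) ^ w.length)) := by
    simpa using hc.sub (tendsto_const_div_atTop_nhds_zero_nat (w.length : ℝ))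
  refine tendsto_of_tendsto_of_tendsto_of_le_of_le hlower hc (fun n => ?_) fun n => ?_
  · simp only
    rw [← sub_div, occ_wpre]
    refine div_le_div_of_nonneg_right ?_ n.cast_nonneg
    rw [sub_le_iff_le_add]
    have hsplit : n + 1 - w.length ≤ n := by omega
    rw [← Finset.sum_range_add_sum_Ico _ hsplit]
    gcongr
    calc _ ≤ ∑ _t ∈ Finset.Ico (n + 1 - w.length) n, (1 : ℝ) :=
          Finset.sum_le_sum fun t _ => h1 _
      _ = ((n - (n + 1 - w.length) : ℕ) : ℝ) := by simp
      _ ≤ w.length := by exact_mod_cast (by omega)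
  · simp only
    rw [occ_wpre]
    refine div_le_div_of_nonneg_right ?_ n.cast_nonneg
    exact Finset.sum_le_sum_of_subset_of_nonneg
      (Finset.range_subset_range.2 (by omega)) fun t _ _ => h0 t

/-- there exists a pair of normal words whose every finite-state shuffle
is normal. -/
theorem stmt_0 (k : ℕ) (hk : 2 ≤ k) :
    ∃ x y : ℕ → Fin k, IsNormal x ∧ IsNormal y ∧
      ∀ S : Shuffler k, IsNormal (S.out x y) := by
  have : NeZero k := ⟨by omega⟩
  have hx := (measurePreserving_fst (μ := unifMeasure k) (ν := unifMeasure k)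
    ).quasiMeasurePreserving.ae (ae_isNormal k)
  have hy := (measurePreserving_snd (μ := unifMeasure k) (ν := unifMeasure k)
    ).quasiMeasurePreserving.ae (ae_isNormal k)
  have hS := ae_all_iff.2 fun S : Shuffler k =>
    S.measurePreserving_out.quasiMeasurePreserving.ae (ae_isNormal k)
  obtain ⟨p, hpx, hpy, hpS⟩ := (hx.and (hy.and hS)).exists
  exact ⟨p.1, p.2, hpx, hpy, hpS⟩
end

section
/- Let Σ be a finite alphabet of size k ≥ 2, let S be any shuffler over Σ, and let x ∈ Σ^∞ be normal. Then for ν^∞-almost every y ∈ Σ^∞ (where ν^∞ is the i.i.d. uniform product measure on Σ^∞), the output S(x,y) is normal. -/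
open MeasureTheory Filter Finset
open scoped ENNReal ProbabilityTheory

/-! ### Blocks of infinite words -/

/-- The length-`m` prefix of an infinite word, as a function on `Fin m`. -/
def block {k : ℕ} (m : ℕ) (y : ℕ → Fin k) : Fin m → Fin k := fun i => y i

/-- The infinite word obtained from a finite word by appending zeros. -/
def extendZero {k : ℕ} [NeZero k] {m : ℕ} (u : Fin m → Fin k) : ℕ → Fin k :=
  fun i => if h : i < m then u ⟨i, h⟩ else 0

/-- The number of positions `t < n` at which the block `w` occurs in `z`. -/
def blockCount {k m : ℕ} (z : ℕ → Fin k) (w : Fin m → Fin k) (n : ℕ) : ℕ :=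
  #{t ∈ range n | block m (fun i => z (t + i)) = w}

section Words

variable {k : ℕ}

theorem extendZero_block [NeZero k] {m : ℕ} (y : ℕ → Fin k) {i : ℕ} (hi : i < m) :
    extendZero (block m y) i = y i := by
  simp [extendZero, block, hi]

theorem extendZero_cons_zero [NeZero k] {m : ℕ} (a : Fin k) (u : Fin m → Fin k) :
    extendZero (Fin.cons a u : Fin (m + 1) → Fin k) 0 = a := by
  simp [extendZero]

theorem extendZero_cons_succ [NeZero k] {m : ℕ} (a : Fin k) (u : Fin m → Fin k) :
    (fun i => extendZero (Fin.cons a u : Fin (m + 1) → Fin k) (i + 1)) = extendZero u := by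
  funext i
  by_cases h : i < m
  · have : (⟨i + 1, by omega⟩ : Fin (m + 1)) = Fin.succ ⟨i, h⟩ := rfl
    simp only [extendZero, Nat.add_lt_add_iff_right, h, dite_true]
    rw [this, Fin.cons_succ]
  · simp [extendZero, h]

theorem sum_words_succ {m : ℕ} (g : (Fin (m + 1) → Fin k) → ℝ) :
    ∑ u, g u = ∑ a : Fin k, ∑ u : Fin m → Fin k, g (Fin.cons a u) := by
  rw [← (Fin.consEquiv (fun _ : Fin (m + 1) => Fin k)).sum_comp, Fintype.sum_prod_type]
  rfl

theorem drop_take_wpre (z : ℕ → Fin k) {t m n : ℕ} (h : t + m ≤ n) :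
    ((wpre z n).drop t).take m = wpre (fun i => z (t + i)) m := by
  apply List.ext_getElem
  · simp [wpre]; omega
  · intro i h1 h2
    simp [wpre]

theorem occ_wpre_s2 (z : ℕ → Fin k) {m : ℕ} (w : Fin m → Fin k) (n : ℕ) :
    occ (wpre z n) (List.ofFn w) = blockCount z w (n + 1 - m) := by
  unfold occ blockCount
  have hl : (wpre z n).length = n := by simp [wpre]
  rw [hl, List.length_ofFn]
  congr 1
  apply Finset.filter_congr
  intro t ht
  rw [Finset.mem_range] at ht
  rw [drop_take_wpre z (by omega)]
  exact List.ofFn_injective.eq_iff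

theorem exists_blockCount_le {x : ℕ → Fin k} (hk : 0 < k) (hx : IsNormal x) {L : ℕ} (hL : 0 < L) :
    ∃ C : ℝ, 0 ≤ C ∧ ∀ (u : Fin L → Fin k) (n : ℕ),
      (blockCount x u (n + 1 - L) : ℝ) ≤ 2 * n / (k : ℝ) ^ L + C := by
  have hkL : (0 : ℝ) < 1 / (k : ℝ) ^ L := by positivity
  have hev : ∀ᶠ n : ℕ in atTop, ∀ u : Fin L → Fin k,
      (blockCount x u (n + 1 - L) : ℝ) / n < 2 * (1 / (k : ℝ) ^ L) := by
    rw [eventually_all]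
    intro u
    have hne : List.ofFn u ≠ [] := by
      intro h
      have := congrArg List.length h
      simp at this
      omega
    have h := hx (List.ofFn u) hne
    simp only [occ_wpre_s2, List.length_ofFn] at h
    exact h.eventually_lt_const (by linarith)
  obtain ⟨N, hN⟩ := eventually_atTop.1 hev
  refine ⟨N, by positivity, fun u n => ?_⟩
  rcases le_or_gt N n with h | h
  · rcases Nat.eq_zero_or_pos n with rfl | hn
    · have : (0 + 1 - L) = 0 := by omega
      simp [this, blockCount]
    · have h1 := hN n h u
      have hn' : (0 : ℝ) < n := by exact_mod_cast hn
      rw [div_lt_iff₀ hn'] at h1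
      have h2 : (0 : ℝ) ≤ N := by positivity
      have h3 : 2 * (1 / (k : ℝ) ^ L) * n = 2 * n / (k : ℝ) ^ L := by ring
      linarith
  · have h1 : blockCount x u (n + 1 - L) ≤ n + 1 - L :=
      (Finset.card_filter_le _ _).trans (by simp)
    have h2 : (blockCount x u (n + 1 - L) : ℝ) ≤ N := by
      exact_mod_cast (by omega : blockCount x u (n + 1 - L) ≤ N)
    have h3 : (0 : ℝ) ≤ 2 * n / (k : ℝ) ^ L := by positivity
    linarith

theorem card_aligned_le (x : ℕ → Fin k) {L : ℕ} (hL : 0 < L) (u : Fin L → Fin k) (N : ℕ) :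
    #{i ∈ range N | block L (fun j => x (i * L + j)) = u} ≤ blockCount x u (N * L + 1 - L) := by
  apply Finset.card_le_card_of_injOn (fun i => i * L)
  · intro i hi
    simp only [coe_filter, mem_range, Set.mem_ofPred_eq] at hi ⊢
    refine ⟨?_, hi.2⟩
    have : (i + 1) * L ≤ N * L := Nat.mul_le_mul_right _ hi.1
    rw [Nat.add_mul] at this
    omega
  · intro i _ j _ h
    exact Nat.eq_of_mul_eq_mul_right hL h

end Words

/-! ### Finite-state gamblers reading two tapes -/

section Gambler

variable {k : ℕ} {Q : Type*} (δ : Q → Fin k → Q) (τ : Q → Bool) (f : Q → Fin k → ℝ)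

/-- Capital after `t` steps of the two-tape gambler started in state `q`, which multiplies its
capital by `f q a` whenever the symbol `a` is read in state `q`. -/
def gain : ℕ → Q → (ℕ → Fin k) → (ℕ → Fin k) → ℝ
  | 0, _, _, _ => 1
  | t + 1, q, x, y =>
    if τ q then f q (x 0) * gain t (δ q (x 0)) (fun i => x (i + 1)) y
    else f q (y 0) * gain t (δ q (y 0)) x (fun i => y (i + 1))

/-- The expectation of `gain` when the second tape is uniformly random. -/
noncomputable def meanGain : ℕ → Q → (ℕ → Fin k) → ℝ
  | 0, _, _ => 1
  | t + 1, q, x =>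
    if τ q then f q (x 0) * meanGain t (δ q (x 0)) (fun i => x (i + 1))
    else (∑ a, f q a * meanGain t (δ q a) x) / k

/-- The expected capital, for a uniformly random second tape, at the moment when the `j`-th symbol
of the first tape has just been read, restricted to the event that this happens within `t` steps. -/
noncomputable def readGain : ℕ → ℕ → Q → (ℕ → Fin k) → ℝ
  | _, 0, _, _ => 1
  | 0, _ + 1, _, _ => 0
  | t + 1, j + 1, q, x =>
    if τ q then f q (x 0) * readGain t j (δ q (x 0)) (fun i => x (i + 1))
    else (∑ a, f q a * readGain t (j + 1) (δ q a) x) / k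

theorem readGain_zero (t : ℕ) (q : Q) (x : ℕ → Fin k) : readGain δ τ f t 0 q x = 1 := by
  cases t <;> rfl

variable {δ τ f}

theorem gain_congr (t : ℕ) (q : Q) (x : ℕ → Fin k) {y y' : ℕ → Fin k}
    (h : ∀ i < t, y i = y' i) : gain δ τ f t q x y = gain δ τ f t q x y' := by
  induction t generalizing q x y y' with
  | zero => rfl
  | succ t ih =>
    simp only [gain]
    rw [h 0 (by omega), ih _ _ (fun i hi => h i (by omega)),
      ih (δ q (y' 0)) x (y := fun i => y (i + 1)) (fun i hi => h (i + 1) (by omega))]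

theorem readGain_congr (t j : ℕ) (q : Q) {x x' : ℕ → Fin k}
    (h : ∀ i < j, x i = x' i) : readGain δ τ f t j q x = readGain δ τ f t j q x' := by
  induction t generalizing j q x x' with
  | zero => cases j <;> rfl
  | succ t ih =>
    cases j with
    | zero => rfl
    | succ j =>
      simp only [readGain]
      rw [h 0 (by omega), ih j (δ q (x' 0)) (x := fun i => x (i + 1))
        (fun i hi => h (i + 1) (by omega))]
      simp only [fun a => ih (j + 1) (δ q a) h]

theorem gain_nonneg (hf : ∀ q a, 0 ≤ f q a) (t : ℕ) (q : Q) (x y : ℕ → Fin k) :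
    0 ≤ gain δ τ f t q x y := by
  induction t generalizing q x y with
  | zero => simp [gain]
  | succ t ih =>
    simp only [gain]
    split_ifs
    · exact mul_nonneg (hf _ _) (ih _ _ _)
    · exact mul_nonneg (hf _ _) (ih _ _ _)

theorem readGain_nonneg (hf : ∀ q a, 0 ≤ f q a) (t j : ℕ) (q : Q) (x : ℕ → Fin k) :
    0 ≤ readGain δ τ f t j q x := by
  induction t generalizing j q x with
  | zero => cases j <;> simp [readGain]
  | succ t ih =>
    cases j with
    | zero => simp [readGain]
    | succ j =>
      simp only [readGain]
      split_ifs
      · exact mul_nonneg (hf _ _) (ih _ _ _)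
      · exact div_nonneg (Finset.sum_nonneg fun a _ => mul_nonneg (hf _ _) (ih _ _ _)) (by simp)

theorem readGain_le_succ (hf : ∀ q a, 0 ≤ f q a) (t j : ℕ) (q : Q) (x : ℕ → Fin k) :
    readGain δ τ f t j q x ≤ readGain δ τ f (t + 1) j q x := by
  induction t generalizing j q x with
  | zero =>
    cases j with
    | zero => simp [readGain]
    | succ j => exact readGain_nonneg hf 1 (j + 1) q x
  | succ t ih =>
    cases j with
    | zero => simp [readGain]
    | succ j =>
      rw [readGain, readGain]
      split_ifs
      · exact mul_le_mul_of_nonneg_left (ih _ _ _) (hf _ _)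
      · gcongr
        · exact hf _ _
        · exact ih _ _ _

theorem readGain_add_le (hf : ∀ q a, 0 ≤ f q a) (t L j : ℕ) (q : Q) (x : ℕ → Fin k) {M : ℝ}
    (hM : ∀ q', readGain δ τ f t j q' (fun i => x (L + i)) ≤ M) :
    readGain δ τ f t (L + j) q x ≤ readGain δ τ f t L q x * M := by
  induction t generalizing L q x with
  | zero =>
    cases L with
    | zero => simpa [readGain] using hM q
    | succ L => simp [readGain, Nat.add_right_comm L 1 j]
  | succ t ih =>
    cases L with
    | zero => simpa [readGain] using hM q
    | succ L =>
      have hM' := fun q' => (readGain_le_succ hf t j q' _).trans (hM q')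
      rw [Nat.add_right_comm L 1 j, readGain, readGain]
      split_ifs
      · rw [mul_assoc]
        refine mul_le_mul_of_nonneg_left (ih L _ _ fun q' => ?_) (hf _ _)
        simpa only [Nat.add_right_comm L 1] using hM' q'
      · rw [div_mul_eq_mul_div, Finset.sum_mul]
        refine div_le_div_of_nonneg_right (Finset.sum_le_sum fun a _ => ?_) (by simp)
        rw [mul_assoc, Nat.add_right_comm L j 1]
        exact mul_le_mul_of_nonneg_left (ih (L + 1) _ _ hM') (hf _ _)

variable [NeZero k]

theorem sum_mul_div_le (hf : ∀ q a, 0 ≤ f q a) (hs : ∀ q, ∑ a, f q a = k) {g : Fin k → ℝ} {M : ℝ}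
    (hg : ∀ a, g a ≤ M) (q : Q) : (∑ a, f q a * g a) / k ≤ M := by
  have hk : (0 : ℝ) < k := by exact_mod_cast NeZero.pos k
  rw [div_le_iff₀ hk, ← hs q, Finset.mul_sum]
  exact Finset.sum_le_sum fun a _ => by
    rw [mul_comm M]; exact mul_le_mul_of_nonneg_left (hg a) (hf q a)

theorem readGain_le_pow (hf : ∀ q a, 0 ≤ f q a) (hs : ∀ q, ∑ a, f q a = k)
    (h2 : ∀ q a, f q a ≤ 2) (t j : ℕ) (q : Q) (x : ℕ → Fin k) :
    readGain δ τ f t j q x ≤ 2 ^ j := by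
  induction t generalizing j q x with
  | zero => cases j <;> simp [readGain]
  | succ t ih =>
    cases j with
    | zero => simp [readGain]
    | succ j =>
      simp only [readGain]
      split_ifs
      · rw [pow_succ, mul_comm]
        exact mul_le_mul (ih _ _ _) (h2 _ _) (hf _ _) (by positivity)
      · exact sum_mul_div_le hf hs (fun a => ih _ _ _) q

theorem sum_readGain_le (hf : ∀ q a, 0 ≤ f q a) (hs : ∀ q, ∑ a, f q a = k) (t j : ℕ) (q : Q) :
    ∑ u : Fin j → Fin k, readGain δ τ f t j q (extendZero u) ≤ (k : ℝ) ^ j := by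
  induction t generalizing j q with
  | zero => cases j <;> simp [readGain]
  | succ t ih =>
    cases j with
    | zero => simp [readGain]
    | succ j =>
      simp only [readGain]
      split_ifs
      · rw [sum_words_succ]
        simp only [extendZero_cons_zero, extendZero_cons_succ, ← Finset.mul_sum]
        calc _ ≤ ∑ a, f q a * (k : ℝ) ^ j :=
              Finset.sum_le_sum fun a _ => mul_le_mul_of_nonneg_left (ih _ _) (hf _ _)
          _ = _ := by rw [← Finset.sum_mul, hs, pow_succ, mul_comm]
      · rw [← Finset.sum_div, Finset.sum_comm]
        simp only [← Finset.mul_sum]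
        exact sum_mul_div_le hf hs (fun a => ih _ _) q

theorem meanGain_le_sum_readGain (hf : ∀ q a, 0 ≤ f q a) (hs : ∀ q, ∑ a, f q a = k)
    (t : ℕ) (q : Q) (x : ℕ → Fin k) :
    meanGain δ τ f t q x ≤ ∑ j ∈ range (t + 1), readGain δ τ f t j q x := by
  have hk : (k : ℝ) ≠ 0 := by exact_mod_cast NeZero.ne k
  induction t generalizing q x with
  | zero => simp [meanGain, readGain]
  | succ t ih =>
    rw [meanGain]
    split_ifs with h
    · rw [Finset.sum_range_succ']
      simp only [readGain, h, if_true, ← Finset.mul_sum]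
      have := mul_le_mul_of_nonneg_left
        (ih (δ q (x 0)) (fun i => x (i + 1))) (hf q (x 0))
      linarith
    · have hstep : (∑ a, f q a * meanGain δ τ f t (δ q a) x) / k ≤
          ∑ j ∈ range (t + 1), readGain δ τ f (t + 1) j q x := by
        calc _ ≤ (∑ a, f q a * ∑ j ∈ range (t + 1), readGain δ τ f t j (δ q a) x) / k := by
              gcongr with a
              · exact hf _ _
              · exact ih _ _
          _ = _ := by
              simp only [Finset.mul_sum]
              rw [Finset.sum_comm, Finset.sum_div]
              refine Finset.sum_congr rfl fun j _ => ?_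
              cases j with
              | zero => simp [readGain_zero, hs, hk]
              | succ j => simp [readGain, h]
      refine hstep.trans ?_
      rw [Finset.sum_range_succ _ (t + 1)]
      linarith [readGain_nonneg (δ := δ) (τ := τ) hf (t + 1) (t + 1) q x]

theorem sum_gain_extendZero (t n : ℕ) (h : t ≤ n) (q : Q) (x : ℕ → Fin k) :
    ∑ u : Fin n → Fin k, gain δ τ f t q x (extendZero u) = (k : ℝ) ^ n * meanGain δ τ f t q x := by
  have hk : (k : ℝ) ≠ 0 := by exact_mod_cast NeZero.ne k
  induction t generalizing n q x with
  | zero => simp [gain, meanGain]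
  | succ t ih =>
    simp only [gain, meanGain]
    split_ifs
    · rw [← Finset.mul_sum, ih n (by omega)]
      ring
    · obtain ⟨n, rfl⟩ : ∃ m, n = m + 1 := ⟨n - 1, by omega⟩
      rw [sum_words_succ]
      simp only [extendZero_cons_zero, extendZero_cons_succ, ← Finset.mul_sum,
        ih n (by omega : t ≤ n)]
      rw [pow_succ, mul_assoc, mul_div_cancel₀ _ hk, Finset.mul_sum]
      exact Finset.sum_congr rfl fun a _ => by ring

/-- For a normal first tape, the expected capital grows subexponentially in the number of symbols
read from that tape. -/
theorem exists_readGain_le [Fintype Q] {x : ℕ → Fin k} (hx : IsNormal x) (hf : ∀ q a, 0 ≤ f q a)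
    (hs : ∀ q, ∑ a, f q a = k) (h2 : ∀ q a, f q a ≤ 2) {ε : ℝ} (hε : 0 < ε) :
    ∃ C : ℝ, 0 ≤ C ∧ ∀ t j q, readGain δ τ f t j q x ≤ C * Real.exp (ε * j) := by
  have hk : (0 : ℝ) < k := by exact_mod_cast NeZero.pos k
  obtain ⟨s, hsdef⟩ : ∃ s : ℝ, s = Fintype.card Q + 1 := ⟨_, rfl⟩
  have hs1 : 1 ≤ s := by rw [hsdef]; linarith [Nat.cast_nonneg (α := ℝ) (Fintype.card Q)]
  obtain ⟨L, hL, hlog⟩ : ∃ L : ℕ, 0 < L ∧ Real.log (2 * s * L) ≤ ε * L := by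
    have hs0 : 0 < 2 * s := by linarith
    have h1 : Tendsto (fun L : ℕ => 2 * s * (L : ℝ)) atTop atTop :=
      tendsto_natCast_atTop_atTop.const_mul_atTop hs0
    have h2 := h1.eventually (Real.isLittleO_log_id_atTop.bound (div_pos hε hs0))
    obtain ⟨L, h, hL⟩ := (h2.and (eventually_gt_atTop 0)).exists
    refine ⟨L, hL, (le_abs_self _).trans (h.trans_eq ?_)⟩
    rw [id, Real.norm_of_nonneg (by positivity)]
    field_simp
  obtain ⟨c, hc⟩ : ∃ c : ℝ, c = 2 * s * L := ⟨_, rfl⟩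
  have hL1 : (1 : ℝ) ≤ L := by exact_mod_cast hL
  have hc1 : 1 ≤ c := by rw [hc]; nlinarith
  obtain ⟨C₀, hC₀, hcount⟩ := exists_blockCount_le (NeZero.pos k) hx hL
  refine ⟨Real.exp (C₀ * s * k ^ L / c) * 2 ^ L, by positivity, fun t j q => ?_⟩
  set B : (ℕ → Fin k) → ℝ := fun y => ∑ q, readGain δ τ f t L q y with hB
  have hB0 : ∀ y, 0 ≤ B y := fun y => Finset.sum_nonneg fun q _ => readGain_nonneg hf _ _ _ _
  have hBsum : ∑ u : Fin L → Fin k, B (extendZero u) ≤ s * (k : ℝ) ^ L := by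
    rw [hB, Finset.sum_comm]
    calc _ ≤ ∑ _q : Q, (k : ℝ) ^ L := Finset.sum_le_sum fun q _ => sum_readGain_le hf hs t L q
      _ ≤ _ := by
        rw [Finset.sum_const, card_univ, nsmul_eq_mul, hsdef]
        gcongr
        linarith
  have hprod : ∀ (N r : ℕ) (y : ℕ → Fin k) (q : Q), readGain δ τ f t (N * L + r) q y ≤
      (∏ i ∈ range N, B (fun j => y (i * L + j))) * 2 ^ r := by
    intro N r
    induction N with
    | zero => intro y q; simpa using readGain_le_pow hf hs h2 t r q y
    | succ N ih =>
      intro y q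
      have h0 : (N + 1) * L + r = L + (N * L + r) := by ring
      rw [h0]
      refine (readGain_add_le hf t L (N * L + r) q y (fun q' => ih _ q')).trans ?_
      rw [Finset.prod_range_succ', mul_comm (∏ i ∈ range N, _) (B _), mul_assoc]
      have e : ∀ i j, y (L + (i * L + j)) = y ((i + 1) * L + j) := fun i j => by congr 1; ring
      simp only [e, zero_mul, zero_add]
      refine mul_le_mul_of_nonneg_right ?_
        (mul_nonneg (Finset.prod_nonneg fun i _ => hB0 _) (by positivity))
      exact Finset.single_le_sum (f := fun q => readGain δ τ f t L q y)
        (fun q _ => readGain_nonneg hf _ _ _ _) (mem_univ q)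
  have hsumB : ∀ N : ℕ, ∑ i ∈ range N, B (fun j => x (i * L + j)) ≤ c * N + C₀ * s * k ^ L := by
    intro N
    have h1 : ∀ i, B (fun j => x (i * L + j)) =
        B (extendZero (block L (fun j => x (i * L + j)))) := fun i =>
      Finset.sum_congr rfl fun q _ =>
        readGain_congr _ _ _ fun l hl => (extendZero_block (fun j => x (i * L + j)) hl).symm
    simp only [h1]
    rw [← Finset.sum_fiberwise' (range N) (fun i => block L (fun j => x (i * L + j)))
      (fun u => B (extendZero u))]
    simp only [Finset.sum_const, nsmul_eq_mul]
    calc _ ≤ ∑ u : Fin L → Fin k, (2 * (N * L : ℕ) / (k : ℝ) ^ L + C₀) * B (extendZero u) := by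
          refine Finset.sum_le_sum fun u _ => mul_le_mul_of_nonneg_right ?_ (hB0 _)
          exact (Nat.cast_le.2 (card_aligned_le x hL u N)).trans (hcount u _)
      _ ≤ (2 * (N * L : ℕ) / (k : ℝ) ^ L + C₀) * (s * (k : ℝ) ^ L) := by
          rw [← Finset.mul_sum]
          gcongr
      _ = _ := by
          rw [hc]; push_cast; field_simp
  have hbound : ∀ N : ℕ, ∏ i ∈ range N, B (fun j => x (i * L + j)) ≤
      c ^ N * Real.exp (C₀ * s * k ^ L / c) := by
    intro N
    have hc0 : 0 < c := by linarith
    calc _ ≤ ∏ i ∈ range N, c * Real.exp (B (fun j => x (i * L + j)) / c - 1) := by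
          refine Finset.prod_le_prod (fun i _ => hB0 _) fun i _ => ?_
          have := Real.add_one_le_exp (B (fun j => x (i * L + j)) / c - 1)
          rw [sub_add_cancel, div_le_iff₀ hc0] at this
          linarith
      _ = c ^ N * Real.exp ((∑ i ∈ range N, B (fun j => x (i * L + j))) / c - N) := by
          rw [Finset.prod_mul_distrib, ← Real.exp_sum, Finset.sum_sub_distrib, ← Finset.sum_div]
          simp
      _ ≤ _ := by
          gcongr
          rw [sub_le_iff_le_add, div_le_iff₀ hc0]
          have := hsumB N
          field_simp
          linarith
  have hj : j = j / L * L + j % L := by rw [mul_comm]; exact (Nat.div_add_mod j L).symm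
  have hpow : c ^ (j / L) ≤ Real.exp (ε * j) := by
    rw [← Real.exp_log (by linarith : 0 < c), ← Real.exp_nat_mul]
    apply Real.exp_le_exp.2
    rw [← hc] at hlog
    calc ((j / L : ℕ) : ℝ) * Real.log c ≤ ((j / L : ℕ) : ℝ) * (ε * L) := by gcongr
      _ = ε * ((j / L * L : ℕ) : ℝ) := by push_cast; ring
      _ ≤ _ := by gcongr; exact Nat.div_mul_le_self j L
  calc readGain δ τ f t j q x = readGain δ τ f t (j / L * L + j % L) q x := by rw [← hj]
    _ ≤ _ := hprod _ _ _ _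
    _ ≤ (Real.exp (ε * j) * Real.exp (C₀ * s * k ^ L / c)) * 2 ^ L := by
        gcongr
        · exact (hbound _).trans (by gcongr)
        · norm_num
        · exact (Nat.mod_lt j hL).le
    _ = _ := by ring

end Gambler

section Almost

variable {k : ℕ} [NeZero k]

theorem lintegral_eq_sum_extendZero {ν : Measure (ℕ → Fin k)} (hν : IsUniformProductMeasure ν)
    {n : ℕ} {g : (ℕ → Fin k) → ℝ≥0∞} (hg : ∀ y y', (∀ i < n, y i = y' i) → g y = g y') :
    ∫⁻ y, g y ∂ν = ∑ u : Fin n → Fin k, g (extendZero u) * ((k : ℝ≥0∞))⁻¹ ^ n := by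
  have hm : Measurable (block (k := k) n) := measurable_pi_lambda _ fun i => measurable_pi_apply _
  have hgb : ∀ y, g y = g (extendZero (block n y)) := fun y =>
    hg _ _ fun i hi => (extendZero_block y hi).symm
  calc ∫⁻ y, g y ∂ν = ∫⁻ y, g (extendZero (block n y)) ∂ν := lintegral_congr hgb
    _ = ∫⁻ u, g (extendZero u) ∂(ν.map (block n)) :=
        (lintegral_map (f := fun u => g (extendZero u)) (measurable_of_finite _) hm).symm
    _ = _ := by
        rw [lintegral_fintype]
        refine Finset.sum_congr rfl fun u _ => ?_
        rw [Measure.map_apply hm (measurableSet_singleton u)]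
        congr 1
        have h := hν.2 (List.ofFn u)
        rw [List.length_ofFn] at h
        rw [← h]
        congr 1
        ext y
        simp only [cyl, wpre, Set.mem_preimage, Set.mem_singleton_iff, Set.mem_ofPred_eq]
        constructor
        · rintro rfl
          apply List.ext_getElem <;> simp [block]
        · intro h
          funext i
          have := congrArg (fun l : List (Fin k) => l[(i : ℕ)]?) h
          simpa [block] using this

variable {Q : Type*} {δ : Q → Fin k → Q} {τ : Q → Bool} {f : Q → Fin k → ℝ}

theorem measurable_gain (t : ℕ) (q : Q) (x : ℕ → Fin k) :
    Measurable fun y => gain δ τ f t q x y := by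
  have hm : Measurable (block (k := k) t) := measurable_pi_lambda _ fun i => measurable_pi_apply _
  have : (fun y => gain δ τ f t q x y) =
      (fun u => gain δ τ f t q x (extendZero u)) ∘ block t := by
    funext y
    exact gain_congr t q x fun i hi => (extendZero_block y hi).symm
  rw [this]
  exact (measurable_of_finite _).comp hm

theorem lintegral_gain {ν : Measure (ℕ → Fin k)} (hν : IsUniformProductMeasure ν)
    (hf : ∀ q a, 0 ≤ f q a) (t : ℕ) (q : Q) (x : ℕ → Fin k) :
    ∫⁻ y, ENNReal.ofReal (gain δ τ f t q x y) ∂ν = ENNReal.ofReal (meanGain δ τ f t q x) := by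
  have hk : (0 : ℝ) < k := by exact_mod_cast NeZero.pos k
  rw [lintegral_eq_sum_extendZero hν (n := t) fun y y' h => by rw [gain_congr t q x h],
    ← Finset.sum_mul, ← ENNReal.ofReal_sum_of_nonneg fun u _ => gain_nonneg hf _ _ _ _,
    sum_gain_extendZero t t le_rfl, ENNReal.ofReal_mul (by positivity),
    ENNReal.ofReal_pow hk.le, ENNReal.ofReal_natCast, mul_right_comm, ← mul_pow,
    ENNReal.mul_inv_cancel (by exact_mod_cast NeZero.ne k) (ENNReal.natCast_ne_top k), one_pow,
    one_mul]

/-- A finite-state gambler reading a normal tape and a random tape has almost surely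
subexponential capital. -/
theorem ae_exists_gain_le [Fintype Q] {x : ℕ → Fin k} (hx : IsNormal x)
    {ν : Measure (ℕ → Fin k)} (hν : IsUniformProductMeasure ν) (hf : ∀ q a, 0 ≤ f q a)
    (hs : ∀ q, ∑ a, f q a = k) (h2 : ∀ q a, f q a ≤ 2) (q : Q) {ε : ℝ} (hε : 0 < ε) :
    ∀ᵐ y ∂ν, ∃ C : ℝ, ∀ t, gain δ τ f t q x y ≤ C * Real.exp (ε * t) := by
  obtain ⟨η, hη, rfl⟩ : ∃ η : ℝ, 0 < η ∧ ε = 3 * η := ⟨ε / 3, by positivity, by ring⟩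
  obtain ⟨C, hC, hK⟩ := exists_readGain_le (δ := δ) (τ := τ) hx hf hs h2 hη
  have hV : ∀ t : ℕ, meanGain δ τ f t q x * Real.exp (-(3 * η * t)) ≤
      C * Real.exp η / η * Real.exp (-η) ^ t := by
    intro t
    have h1 : meanGain δ τ f t q x ≤ (t + 1) * (C * Real.exp (η * t)) :=
      calc _ ≤ _ := meanGain_le_sum_readGain hf hs t q x
        _ ≤ ∑ _j ∈ range (t + 1), C * Real.exp (η * t) := by
            refine Finset.sum_le_sum fun j hj => (hK t j q).trans ?_
            have : j ≤ t := by simpa [Nat.lt_succ_iff] using hj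
            gcongr
        _ = _ := by simp
    have h2 : (t + 1 : ℝ) ≤ Real.exp (η * (t + 1)) / η := by
      rw [le_div_iff₀ hη]
      linarith [Real.add_one_le_exp (η * (t + 1))]
    calc _ ≤ (Real.exp (η * (t + 1)) / η * (C * Real.exp (η * t))) *
          Real.exp (-(3 * η * t)) := by
          gcongr
          exact h1.trans (by gcongr)
      _ = C / η * (Real.exp (η * (t + 1)) * Real.exp (η * t) * Real.exp (-(3 * η * t))) := by ring
      _ = C / η * (Real.exp η * Real.exp (-η) ^ t) := by
          rw [← Real.exp_nat_mul, ← Real.exp_add, ← Real.exp_add, ← Real.exp_add]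
          congr 2
          ring
      _ = _ := by ring
  have hsum : Summable fun t : ℕ => C * Real.exp η / η * Real.exp (-η) ^ t :=
    (summable_geometric_of_lt_one (Real.exp_nonneg _)
      (by simpa using hη)).mul_left _
  have hmeas : ∀ t : ℕ, Measurable fun y =>
      ENNReal.ofReal (gain δ τ f t q x y * Real.exp (-(3 * η * t))) := fun t =>
    ((measurable_gain t q x).mul_const _).ennreal_ofReal
  have hfin : ∫⁻ y, ∑' t : ℕ, ENNReal.ofReal (gain δ τ f t q x y * Real.exp (-(3 * η * t))) ∂ν
      ≠ ∞ := by
    rw [lintegral_tsum fun t => (hmeas t).aemeasurable]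
    refine ne_top_of_le_ne_top (hsum.tsum_ofReal_ne_top) (ENNReal.tsum_le_tsum fun t => ?_)
    simp only [ENNReal.ofReal_mul (gain_nonneg hf _ _ _ _)]
    rw [lintegral_mul_const _ (measurable_gain t q x).ennreal_ofReal, lintegral_gain hν hf,
      ← ENNReal.ofReal_mul' (Real.exp_nonneg _)]
    exact ENNReal.ofReal_le_ofReal (hV t)
  filter_upwards [ae_lt_top (Measurable.tsum hmeas) hfin] with y hy
  refine ⟨(∑' t : ℕ, ENNReal.ofReal (gain δ τ f t q x y * Real.exp (-(3 * η * t)))).toReal,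
    fun t => ?_⟩
  have h1 := ENNReal.toReal_mono hy.ne (ENNReal.le_tsum (f := fun t : ℕ =>
    ENNReal.ofReal (gain δ τ f t q x y * Real.exp (-(3 * η * t)))) t)
  rw [ENNReal.toReal_ofReal (mul_nonneg (gain_nonneg hf _ _ _ _) (Real.exp_nonneg _)),
    Real.exp_neg, ← div_eq_mul_inv, div_le_iff₀ (Real.exp_pos _)] at h1
  exact h1

end Almost

theorem exp_sub_sq_le {u : ℝ} (h : |u| ≤ 1 / 4) : Real.exp (u - u ^ 2) ≤ 1 + u := by
  obtain ⟨h1, h2⟩ := abs_le.1 h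
  have hpos : 0 < 1 + u := by linarith
  suffices 1 ≤ (1 + u) * Real.exp (u ^ 2 - u) by
    have e : u - u ^ 2 = -(u ^ 2 - u) := by ring
    rw [e, Real.exp_neg, inv_le_comm₀ (Real.exp_pos _) hpos, inv_eq_one_div, div_le_iff₀ hpos]
    linarith
  rcases le_total 0 u with hu | hu
  · have := Real.add_one_le_exp (u ^ 2 - u)
    nlinarith [pow_nonneg hu 3, mul_le_mul_of_nonneg_left this hpos.le]
  · have := Real.quadratic_le_exp_of_nonneg (x := u ^ 2 - u) (by nlinarith)
    nlinarith [mul_le_mul_of_nonneg_left this hpos.le, sq_nonneg u, sq_nonneg (u ^ 2),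
      mul_nonneg (sq_nonneg u) (by linarith : 0 ≤ 1 + 3 * u),
      mul_nonneg (sq_nonneg u) (sq_nonneg u),
      mul_nonneg (mul_nonneg (sq_nonneg u) (sq_nonneg u)) (by linarith : 0 ≤ 1 + u),
      mul_nonneg (mul_nonneg (sq_nonneg u) (sq_nonneg u)) (by linarith : 0 ≤ -u),
      mul_nonneg (sq_nonneg u) (by linarith : 0 ≤ -u)]

/-! ### The shuffled word -/

section Shuffled

variable {k : ℕ} [NeZero k]

/-- The last `m` symbols of `z` before position `s`, padded with zeros on the left. -/
def history (m : ℕ) (z : ℕ → Fin k) (s : ℕ) : Fin m → Fin k :=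
  fun i => if m ≤ s + i then z (s + i - m) else 0

/-- Append a symbol to a block and drop its first symbol. -/
def pushLast {m : ℕ} (g : Fin m → Fin k) (a : Fin k) : Fin m → Fin k :=
  fun i => if h : (i : ℕ) + 1 < m then g ⟨i + 1, h⟩ else a

theorem history_succ (m : ℕ) (z : ℕ → Fin k) (s : ℕ) :
    history m z (s + 1) = pushLast (history m z s) (z s) := by
  funext i
  have hi := i.2
  by_cases h : (i : ℕ) + 1 < m
  · simp [history, pushLast, h, add_assoc, add_comm 1]
  · have h1 : m ≤ s + 1 + i := by omega
    have h2 : s + 1 + i - m = s := by omega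
    simp [history, pushLast, h, h1, h2]

theorem history_add (m : ℕ) (z : ℕ → Fin k) (t : ℕ) :
    history m z (m + t) = block m (fun i => z (t + i)) := by
  funext i
  have h1 : m ≤ m + t + i := by omega
  have h2 : m + t + i - m = t + i := by omega
  simp [history, block, h1, h2]

theorem gain_shuffler (S : Shuffler k) {m : ℕ} (F : (Fin m → Fin k) → Fin k → ℝ)
    (x y : ℕ → Fin k) (t s : ℕ) :
    gain (fun (p : Fin S.n × (Fin m → Fin k)) a => (S.δ p.1 a, pushLast p.2 a))
      (fun p => S.τ p.1) (fun p a => F p.2 a) t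
      ((S.conf x y s).1, history m (S.out x y) s)
      (fun i => x ((S.conf x y s).2.1 + i)) (fun i => y ((S.conf x y s).2.2 + i)) =
    ∏ i ∈ range t, F (history m (S.out x y) (s + i)) (S.out x y (s + i)) := by
  induction t generalizing s with
  | zero => simp [gain]
  | succ t ih =>
    rw [Finset.prod_range_succ', mul_comm]
    have ih' := ih (s + 1)
    rw [history_succ] at ih'
    simp only [Nat.add_right_comm s 1] at ih'
    simp only [add_assoc] at ih'
    simp only [gain, add_zero]
    rw [← ih']
    by_cases h : S.τ (S.conf x y s).1
    · simp [h, Shuffler.conf, Shuffler.out, add_assoc, add_comm 1]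
    · simp [h, Shuffler.conf, Shuffler.out, add_assoc, add_comm 1]

theorem ae_eventually_sum_history_le (S : Shuffler k) {x : ℕ → Fin k} (hx : IsNormal x)
    {ν : Measure (ℕ → Fin k)} (hν : IsUniformProductMeasure ν) {m : ℕ}
    {φ : (Fin m → Fin k) → Fin k → ℝ} (hφ : ∀ g a, |φ g a| ≤ 1) (hs : ∀ g, ∑ a, φ g a = 0)
    {ε : ℝ} (hε : 0 < ε) :
    ∀ᵐ y ∂ν, ∀ᶠ n : ℕ in atTop,
      ∑ i ∈ range n, φ (history m (S.out x y) i) (S.out x y i) ≤ ε * n := by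
  obtain ⟨l, hl0, hl, hlε⟩ : ∃ l : ℝ, 0 < l ∧ l ≤ 1 / 4 ∧ 3 * l ≤ ε :=
    ⟨min (1 / 4) (ε / 3), by positivity, min_le_left _ _,
      by linarith [min_le_right (1 / 4) (ε / 3)]⟩
  have hlφ : ∀ g a, |l * φ g a| ≤ l := fun g a => by
    rw [abs_mul, abs_of_pos hl0]
    exact mul_le_of_le_one_right hl0.le (hφ g a)
  have key := ae_exists_gain_le (ν := ν)
    (δ := fun (p : Fin S.n × (Fin m → Fin k)) a => (S.δ p.1 a, pushLast p.2 a))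
    (τ := fun p => S.τ p.1) (f := fun p a => 1 + l * φ p.2 a) hx hν
    (fun p a => by linarith [(abs_le.1 (hlφ p.2 a)).1])
    (fun p => by simp [Finset.sum_add_distrib, ← Finset.mul_sum, hs])
    (fun p a => by linarith [(abs_le.1 (hlφ p.2 a)).2])
    (S.q0, fun _ => 0) (ε := l ^ 2) (by positivity)
  filter_upwards [key] with y ⟨C, hC⟩
  have hbig : ∀ᶠ n : ℕ in atTop, C ≤ Real.exp (l ^ 2 * n) :=
    (Real.tendsto_exp_atTop.comp
      (tendsto_natCast_atTop_atTop.const_mul_atTop (by positivity))).eventually_ge_atTop C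
  filter_upwards [hbig] with n hn
  have h0 := gain_shuffler S (fun g a => 1 + l * φ g a) x y n 0
  have hh : history m (S.out x y) 0 = fun _ => 0 := by
    funext i
    simp [history, i.2]
  simp only [Shuffler.conf, hh, zero_add] at h0
  have h1 := hC n
  rw [h0] at h1
  set φs : ℕ → ℝ := fun i => φ (history m (S.out x y) i) (S.out x y i) with hφs
  have h2 : Real.exp (l * ∑ i ∈ range n, φs i - l ^ 2 * n) ≤ ∏ i ∈ range n, (1 + l * φs i) :=
    calc _ ≤ Real.exp (∑ i ∈ range n, (l * φs i - (l * φs i) ^ 2)) := by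
          apply Real.exp_le_exp.2
          rw [Finset.sum_sub_distrib, ← Finset.mul_sum]
          have : ∑ i ∈ range n, (l * φs i) ^ 2 ≤ ∑ _i ∈ range n, l ^ 2 :=
            Finset.sum_le_sum fun i _ => sq_le_sq' (abs_le.1 (hlφ _ _)).1 (abs_le.1 (hlφ _ _)).2
          simp only [Finset.sum_const, card_range, nsmul_eq_mul] at this
          linarith
      _ = ∏ i ∈ range n, Real.exp (l * φs i - (l * φs i) ^ 2) := Real.exp_sum _ _
      _ ≤ _ := Finset.prod_le_prod (fun i _ => Real.exp_nonneg _) fun i _ =>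
          exp_sub_sq_le ((hlφ _ _).trans hl)
  have h3 : Real.exp (l * ∑ i ∈ range n, φs i - l ^ 2 * n) ≤ Real.exp (l ^ 2 * n + l ^ 2 * n) := by
    rw [Real.exp_add]
    exact h2.trans (h1.trans (by gcongr))
  have h4 := Real.exp_le_exp.1 h3
  have h5 : l * ∑ i ∈ range n, φs i ≤ l * (3 * l * n) := by linarith
  exact (le_of_mul_le_mul_left h5 hl0).trans (by gcongr)

theorem ae_tendsto_sum_history (S : Shuffler k) {x : ℕ → Fin k} (hx : IsNormal x)
    {ν : Measure (ℕ → Fin k)} (hν : IsUniformProductMeasure ν) {m : ℕ}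
    {φ : (Fin m → Fin k) → Fin k → ℝ} (hφ : ∀ g a, |φ g a| ≤ 1) (hs : ∀ g, ∑ a, φ g a = 0) :
    ∀ᵐ y ∂ν, Tendsto (fun n : ℕ =>
      (∑ i ∈ range n, φ (history m (S.out x y) i) (S.out x y i)) / n) atTop (nhds 0) := by
  have h1 : ∀ᵐ y ∂ν, ∀ r : ℕ, ∀ᶠ n : ℕ in atTop,
      ∑ i ∈ range n, φ (history m (S.out x y) i) (S.out x y i) ≤ 1 / ((r : ℝ) + 1) * n :=
    ae_all_iff.2 fun r => ae_eventually_sum_history_le S hx hν hφ hs Nat.one_div_pos_of_nat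
  have h2 : ∀ᵐ y ∂ν, ∀ r : ℕ, ∀ᶠ n : ℕ in atTop,
      ∑ i ∈ range n, -φ (history m (S.out x y) i) (S.out x y i) ≤ 1 / ((r : ℝ) + 1) * n :=
    ae_all_iff.2 fun r => ae_eventually_sum_history_le S hx hν (φ := fun g a => -φ g a)
      (by simpa using hφ) (by simpa using hs) Nat.one_div_pos_of_nat
  filter_upwards [h1, h2] with y h1 h2
  rw [Metric.tendsto_nhds]
  intro ε hε
  obtain ⟨r, hr⟩ := exists_nat_one_div_lt hε
  filter_upwards [h1 r, h2 r, eventually_gt_atTop 0] with n h1 h2 hn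
  have hn' : (0 : ℝ) < n := by exact_mod_cast hn
  rw [Finset.sum_neg_distrib] at h2
  rw [dist_zero_right, Real.norm_eq_abs, abs_div, abs_of_pos hn']
  refine lt_of_le_of_lt ?_ hr
  rw [div_le_iff₀ hn', abs_le]
  constructor <;> linarith

end Shuffled

/-! ### Normality from conditional frequencies -/

theorem isNormal_of_tendsto_blockCount {k : ℕ} {z : ℕ → Fin k}
    (h : ∀ (m : ℕ) (w : Fin m → Fin k),
      Tendsto (fun n : ℕ => (blockCount z w n : ℝ) / n) atTop (nhds (1 / (k : ℝ) ^ m))) :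
    IsNormal z := by
  intro w hw
  obtain ⟨m, hm⟩ : ∃ m, w.length = m + 1 :=
    ⟨w.length - 1, by have := List.length_pos_iff.2 hw; omega⟩
  rw [← tendsto_add_atTop_iff_nat m]
  have h1 := h w.length w.get
  have h2 : Tendsto (fun n : ℕ => (n : ℝ) / ((n + m : ℕ) : ℝ)) atTop (nhds 1) := by
    have := tendsto_natCast_div_add_atTop (𝕜 := ℝ) (m : ℝ)
    exact_mod_cast this
  have h3 := h1.mul h2
  rw [mul_one] at h3
  refine h3.congr' <| (eventually_gt_atTop 0).mono fun n hn => ?_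
  have hn' : (n : ℝ) ≠ 0 := by positivity
  have e : occ (wpre z (n + m)) w = blockCount z w.get n := by
    conv_lhs => rw [← List.ofFn_get w]
    rw [occ_wpre_s2]
    congr 1
    omega
  simp only [e]
  field_simp

section Conditional

variable {k : ℕ} [NeZero k]

theorem sum_history_add (z : ℕ → Fin k) {m : ℕ} (w : Fin m → Fin k) (a : Fin k) (n : ℕ) :
    ∑ i ∈ range (m + n), (if history m z i = w then (if z i = a then (1 : ℝ) else 0) - 1 / k else 0)
      = ∑ i ∈ range m, (if history m z i = w then (if z i = a then (1 : ℝ) else 0) - 1 / k else 0)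
        + (blockCount z (Fin.snoc w a : Fin (m + 1) → Fin k) n - blockCount z w n / k) := by
  rw [Finset.sum_range_add]
  congr 1
  have hsnoc : ∀ t, block (m + 1) (fun i => z (t + i)) = (Fin.snoc w a : Fin (m + 1) → Fin k) ↔
      block m (fun i => z (t + i)) = w ∧ z (m + t) = a := by
    intro t
    rw [← Fin.snoc_init_self (block (m + 1) fun i => z (t + i)), Fin.snoc_injective2.eq_iff,
      add_comm m t]
    rfl
  simp only [blockCount, Finset.card_filter, history_add, hsnoc]
  push_cast
  rw [Finset.sum_div, ← Finset.sum_sub_distrib]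
  refine Finset.sum_congr rfl fun t _ => ?_
  by_cases h1 : block m (fun i => z (t + i)) = w <;> by_cases h2 : z (m + t) = a <;> simp [h1, h2]

theorem tendsto_blockCount_div {z : ℕ → Fin k}
    (h : ∀ (m : ℕ) (w : Fin m → Fin k) (a : Fin k), Tendsto (fun n : ℕ =>
      (∑ i ∈ range n, if history m z i = w then (if z i = a then (1 : ℝ) else 0) - 1 / k else 0) / n)
      atTop (nhds 0)) (m : ℕ) (w : Fin m → Fin k) :
    Tendsto (fun n : ℕ => (blockCount z w n : ℝ) / n) atTop (nhds (1 / (k : ℝ) ^ m)) := by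
  induction m with
  | zero =>
    have : ∀ n, blockCount z w n = n := fun n => by
      simp [blockCount, Subsingleton.elim _ w]
    simp only [this, pow_zero, div_one]
    exact tendsto_const_nhds.congr' <| (eventually_gt_atTop 0).mono fun n hn =>
      (div_self (by positivity)).symm
  | succ m ih =>
    rw [← Fin.snoc_init_self w]
    generalize Fin.init w = v
    generalize w (Fin.last m) = a
    set A : ℕ → ℝ := fun i =>
      if history m z i = v then (if z i = a then (1 : ℝ) else 0) - 1 / k else 0
    have h1 : Tendsto (fun n : ℕ => (∑ i ∈ range (m + n), A i) / ((m + n : ℕ) : ℝ)) atTop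
        (nhds 0) := (h m v a).comp (tendsto_add_atTop_nat m |>.congr fun n => add_comm n m)
    have h2 : Tendsto (fun n : ℕ => ((m + n : ℕ) : ℝ) / n) atTop (nhds 1) := by
      have h3 := (tendsto_const_div_atTop_nhds_zero_nat (m : ℝ)).add_const 1
      rw [zero_add] at h3
      refine h3.congr' <| (eventually_gt_atTop 0).mono fun n hn => ?_
      have : (n : ℝ) ≠ 0 := by positivity
      push_cast
      field_simp
    have h3 := ((h1.mul h2).sub (tendsto_const_div_atTop_nhds_zero_nat
      (∑ i ∈ range m, A i))).add ((ih v).div_const (k : ℝ))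
    have e : (0 : ℝ) * 1 - 0 + 1 / (k : ℝ) ^ m / k = 1 / (k : ℝ) ^ (m + 1) := by
      rw [pow_succ, div_div]; ring
    rw [e] at h3
    refine h3.congr' <| (eventually_gt_atTop 0).mono fun n hn => ?_
    have hn' : (n : ℝ) ≠ 0 := by positivity
    have hmn : ((m + n : ℕ) : ℝ) ≠ 0 := by positivity
    have hk : (k : ℝ) ≠ 0 := by exact_mod_cast NeZero.ne k
    have hA : ∑ i ∈ range (m + n), A i = ∑ i ∈ range m, A i +
        (blockCount z (Fin.snoc v a : Fin (m + 1) → Fin k) n - blockCount z v n / k) :=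
      sum_history_add z v a n
    rw [hA]
    generalize ∑ i ∈ range m, A i = σ
    field_simp
    ring

end Conditional

/-- for a fixed shuffler `S` and normal `x`, almost every `y`
(w.r.t. the i.i.d. uniform product measure) gives a normal output `S(x,y)`. -/
theorem stmt_2 (k : ℕ) (hk : 2 ≤ k) (S : Shuffler k) (x : ℕ → Fin k) (hx : IsNormal x)
    (ν : Measure (ℕ → Fin k)) (hν : IsUniformProductMeasure ν) :
    ∀ᵐ y ∂ν, IsNormal (S.out x y) := by
  have : NeZero k := ⟨by omega⟩
  have hk1 : (1 : ℝ) ≤ k := by exact_mod_cast (by omega : 1 ≤ k)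
  have hinv : 1 / (k : ℝ) ≤ 1 := by rw [div_le_one (by linarith)]; exact hk1
  have hinv0 : 0 ≤ 1 / (k : ℝ) := by positivity
  have hall : ∀ᵐ y ∂ν, ∀ (m : ℕ) (w : Fin m → Fin k) (a : Fin k), Tendsto (fun n : ℕ =>
      (∑ i ∈ range n, if history m (S.out x y) i = w then
        (if S.out x y i = a then (1 : ℝ) else 0) - 1 / k else 0) / n) atTop (nhds 0) := by
    simp only [ae_all_iff]
    intro m w a
    refine ae_tendsto_sum_history S hx hν
      (φ := fun g b => if g = w then (if b = a then (1 : ℝ) else 0) - 1 / k else 0) ?_ ?_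
    · intro g b
      rw [abs_le]
      split_ifs <;> constructor <;> linarith
    · intro g
      split_ifs
      · rw [Finset.sum_sub_distrib]
        simp
      · simp
  filter_upwards [hall] with y hy
  exact isNormal_of_tendsto_blockCount (tendsto_blockCount_div hy)
end
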